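/- arXiv:2204.05935 — 2 statements merged into one kernel-verified Lean document; each statement's English description precedes it below -/
import Mathlib

section
/- In the Marsh–Rietsch setup over ℂ with all parameters t_r ≠ 0: for every i ∈ {1,…,n}, Δ^{{1,…,i}}_{w⁻¹({1,…,i})}(g) = ∏_{r∈J°} t_r^{[p_r(i_r) ≤ i] − [p_r(i_r+1) ≤ i]}, where p_r := s_{i_1}∘s_{i_2}∘···∘s_{i_{r−1}} (the empty composition, for r = 1, being the identity permutation) and w⁻¹({1,…,i}) = {w⁻¹(1),…,w⁻¹(i)}. -/
open Matrix Finset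

namespace Paper

open scoped Classical

noncomputable section

variable {K : Type*} [Field K] {n m : ℕ}

/-- `N`: upper unitriangular matrices. -/
def IsN (g : Matrix (Fin n) (Fin n) K) : Prop :=
  (∀ i, g i i = 1) ∧ ∀ i j : Fin n, j < i → g i j = 0

/-- `N₋`: lower unitriangular matrices. -/
def IsNm (g : Matrix (Fin n) (Fin n) K) : Prop :=
  (∀ i, g i i = 1) ∧ ∀ i j : Fin n, i < j → g i j = 0

/-- `B`: upper triangular matrices of determinant 1. -/
def IsB (g : Matrix (Fin n) (Fin n) K) : Prop :=
  g.det = 1 ∧ ∀ i j : Fin n, j < i → g i j = 0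

/-- `B₋`: lower triangular matrices of determinant 1. -/
def IsBm (g : Matrix (Fin n) (Fin n) K) : Prop :=
  g.det = 1 ∧ ∀ i j : Fin n, i < j → g i j = 0

/-- `H`: diagonal matrices of determinant 1. -/
def IsH (g : Matrix (Fin n) (Fin n) K) : Prop :=
  g.det = 1 ∧ ∀ i j : Fin n, i ≠ j → g i j = 0

/-- UDL factorization: `g = yp * y0 * ym` with `yp ∈ N`, `y0 ∈ H`, `ym ∈ N₋`. -/
def UDL (g yp y0 ym : Matrix (Fin n) (Fin n) K) : Prop :=
  IsN yp ∧ IsH y0 ∧ IsNm ym ∧ g = yp * y0 * ym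

/-- LDU factorization: `g = zm * z0 * zp` with `zm ∈ N₋`, `z0 ∈ H`, `zp ∈ N`. -/
def LDU (g zm z0 zp : Matrix (Fin n) (Fin n) K) : Prop :=
  IsNm zm ∧ IsH z0 ∧ IsN zp ∧ g = zm * z0 * zp

/-- The signed permutation matrix `v̇`. -/
def pdot (v : Equiv.Perm (Fin n)) : Matrix (Fin n) (Fin n) K :=
  Matrix.of fun a b : Fin n =>
    if a = v b then
      (-1 : K) ^ (univ.filter fun k : Fin n => b < k ∧ v k < v b).card
    else 0

/-- Membership in the double coset `B₋ w B₋`. -/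
def InBmWBm (w : Equiv.Perm (Fin n)) (g : Matrix (Fin n) (Fin n) K) : Prop :=
  ∃ b₁ b₂ : Matrix (Fin n) (Fin n) K, IsBm b₁ ∧ IsBm b₂ ∧ g = b₁ * pdot w * b₂

/-- `Δ^I_J(g)`: the minor with row set `I` and column set `J` (junk value 0 if sizes differ). -/
def minor (g : Matrix (Fin n) (Fin n) K) (I J : Finset (Fin n)) : K :=
  if h : I.card = J.card then
    Matrix.det (Matrix.of fun a b : Fin I.card =>
      g (I.orderEmbOfFin rfl a) (J.orderEmbOfFin h.symm b))
  else 0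

/-- All right-aligned flag minors of `g` are nonnegative. -/
def RightFlagNonneg (g : Matrix (Fin n) (Fin n) ℝ) : Prop :=
  ∀ I : Finset (Fin n),
    0 ≤ minor g I (univ.filter fun j : Fin n => n - I.card ≤ (j : ℕ))

/-- All top-aligned flag minors of `g` are nonnegative. -/
def TopFlagNonneg (g : Matrix (Fin n) (Fin n) ℝ) : Prop :=
  ∀ J : Finset (Fin n),
    0 ≤ minor g (univ.filter fun i : Fin n => (i : ℕ) < J.card) J

/-- `x_i(t)` (with 1-based `i`): `Id + t·E_{i,i+1}`. -/
def xmat (i : ℕ) (t : K) : Matrix (Fin n) (Fin n) K :=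
  Matrix.of fun a b : Fin n =>
    if a = b then 1 else if (a : ℕ) + 1 = i ∧ (b : ℕ) = i then t else 0

/-- `y_i(t)` (with 1-based `i`): `Id + t·E_{i+1,i}`. -/
def ymat (i : ℕ) (t : K) : Matrix (Fin n) (Fin n) K :=
  Matrix.of fun a b : Fin n =>
    if a = b then 1 else if (a : ℕ) = i ∧ (b : ℕ) + 1 = i then t else 0

/-- `ṡ_i` (with 1-based `i`). -/
def sdot (i : ℕ) : Matrix (Fin n) (Fin n) K :=
  Matrix.of fun a b : Fin n =>
    if (a : ℕ) + 1 = i ∧ (b : ℕ) = i then 1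
    else if (a : ℕ) = i ∧ (b : ℕ) + 1 = i then -1
    else if a = b ∧ (a : ℕ) + 1 ≠ i ∧ (a : ℕ) ≠ i then 1
    else 0

/-- The adjacent transposition `s_i` (with 1-based `i`); identity if out of range. -/
def sperm (n : ℕ) (i : ℕ) : Equiv.Perm (Fin n) :=
  if h : i < n then
    Equiv.swap ⟨i - 1, Nat.lt_of_le_of_lt (Nat.sub_le i 1) h⟩ ⟨i, h⟩
  else 1

/-- `ℓ(w)`: the number of inversions of `w`. -/
def len (w : Equiv.Perm (Fin n)) : ℕ :=
  (univ.filter fun p : Fin n × Fin n => p.1 < p.2 ∧ w p.2 < w p.1).card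

/-- `vseq ii v k = v_{(m-k)}`: the rightmost (positive distinguished) subexpression recursion. -/
def vseq (ii : Fin m → ℕ) (v : Equiv.Perm (Fin n)) : ℕ → Equiv.Perm (Fin n)
  | 0 => v
  | k + 1 =>
    if h : m - k - 1 < m then
      if len (vseq ii v k * sperm n (ii ⟨m - k - 1, h⟩)) < len (vseq ii v k) then
        vseq ii v k * sperm n (ii ⟨m - k - 1, h⟩)
      else vseq ii v k
    else vseq ii v k

/-- `r ∈ J°` (0-based `r`, corresponding to the 1-based index `r+1`). -/
def inJ (ii : Fin m → ℕ) (v : Equiv.Perm (Fin n)) (r : Fin m) : Prop :=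
  vseq ii v (m - (r : ℕ)) = vseq ii v (m - (r : ℕ) - 1)

/-- The list `[s_{i_1}, …, s_{i_m}]` of adjacent transpositions. -/
def sPermList (n : ℕ) (ii : Fin m → ℕ) : List (Equiv.Perm (Fin n)) :=
  List.ofFn fun r => sperm n (ii r)

/-- The list `[s^v_{i_1}, …, s^v_{i_m}]`. -/
def svPermList (ii : Fin m → ℕ) (v : Equiv.Perm (Fin n)) : List (Equiv.Perm (Fin n)) :=
  List.ofFn fun r => if inJ ii v r then 1 else sperm n (ii r)

/-- The factors `g_1, …, g_m` of the Marsh–Rietsch element. -/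
def mrgList (ii : Fin m → ℕ) (v : Equiv.Perm (Fin n)) (t : Fin m → K) :
    List (Matrix (Fin n) (Fin n) K) :=
  List.ofFn fun r => if inJ ii v r then xmat (ii r) (t r) else sdot (ii r)

/-- The Marsh–Rietsch element `g = g_1 ⋯ g_m`. -/
def mrg (ii : Fin m → ℕ) (v : Equiv.Perm (Fin n)) (t : Fin m → K) :
    Matrix (Fin n) (Fin n) K :=
  (mrgList ii v t).prod

/-- The list `[ṡ_{i_1}, …, ṡ_{i_m}]`. -/
def sdotList (n : ℕ) (ii : Fin m → ℕ) : List (Matrix (Fin n) (Fin n) K) :=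
  List.ofFn fun r => sdot (ii r)

/-- `ẇ = ṡ_{i_1} ⋯ ṡ_{i_m}`. -/
def wMR (n : ℕ) (ii : Fin m → ℕ) : Matrix (Fin n) (Fin n) K :=
  (sdotList n ii).prod

/-! ### helper material -/

def Dm {k : ℕ} (e : Fin k → Fin n) (G : Matrix (Fin n) (Fin n) K) (f : Fin k → Fin n) : K :=
  (Matrix.of fun a b : Fin k => G (e a) (f b)).det

def Nc {k : ℕ} (f : Fin k → Fin n) (c : ℕ) : ℕ := (univ.filter fun a => (f a : ℕ) < c).card

def Cc {k : ℕ} (f : Fin k → Fin n) (c : ℕ) : ℕ := (univ.filter fun a => (f a : ℕ) = c).card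

lemma Nc_succ {k : ℕ} (f : Fin k → Fin n) (c : ℕ) : Nc f (c+1) = Nc f c + Cc f c := by
  unfold Nc Cc
  rw [← Finset.card_union_of_disjoint]
  · congr 1
    ext a
    simp only [mem_filter, mem_univ, true_and, mem_union]
    omega
  · rw [Finset.disjoint_filter]
    intro a _ h
    omega

lemma Cc_le_one {k : ℕ} (f : Fin k → Fin n) (hf : Function.Injective f) (c : ℕ) :
    Cc f c ≤ 1 := by
  unfold Cc
  rw [Finset.card_le_one]
  intro a ha b hb
  simp only [mem_filter, mem_univ, true_and] at ha hb
  exact hf (Fin.ext (ha.trans hb.symm))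

lemma Cc_pos {k : ℕ} (f : Fin k → Fin n) (x : Fin n) : 0 < Cc f x ↔ ∃ a, f a = x := by
  unfold Cc
  rw [Finset.card_pos]
  simp [Finset.Nonempty, Fin.ext_iff]

lemma swap_val (P Q x : Fin n) : ((Equiv.swap P Q x : Fin n) : ℕ) =
    if (x : ℕ) = P then (Q : ℕ) else if (x : ℕ) = Q then (P : ℕ) else x := by
  rw [Equiv.swap_apply_def]
  simp only [← Fin.ext_iff]
  split_ifs <;> rfl

lemma Nc_swap {k : ℕ} (P Q : Fin n) (hPQ : (Q : ℕ) = P + 1) (f : Fin k → Fin n) (c : ℕ)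
    (hc : c ≠ Q) : Nc (Equiv.swap P Q ∘ f) c = Nc f c := by
  unfold Nc
  congr 1
  ext a
  simp only [mem_filter, mem_univ, true_and, Function.comp, swap_val]
  split_ifs <;> omega

lemma Cc_swap {k : ℕ} (P Q : Fin n) (hPQ : (Q : ℕ) = P + 1) (f : Fin k → Fin n) :
    Cc (Equiv.swap P Q ∘ f) P = Cc f Q := by
  unfold Cc
  congr 1
  ext a
  simp only [mem_filter, mem_univ, true_and, Function.comp, swap_val]
  split_ifs <;> omega

lemma gale_step {k : ℕ} (P Q : Fin n) (hPQ : (Q : ℕ) = P + 1) (f h : Fin k → Fin n)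
    (hf : Function.Injective f)
    (hc : (∃ a, h a = Q) → ∃ a, h a = P) (hh : Function.Injective h)
    (hle : ∀ c, Nc h c ≤ Nc f c) (c : ℕ) :
    Nc (Equiv.swap P Q ∘ h) c ≤ Nc f c ∧
    Nc (Equiv.swap P Q ∘ h) c ≤ Nc (Equiv.swap P Q ∘ f) c := by
  by_cases hcQ : c = Q
  · subst hcQ
    have e1 := Nc_succ f P
    have e2 := Nc_succ h P
    have e3 := Nc_succ (Equiv.swap P Q ∘ f) P
    have e4 := Nc_succ (Equiv.swap P Q ∘ h) P
    have e5 := Nc_succ f Q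
    have e6 := Nc_succ h Q
    rw [Cc_swap P Q hPQ, Nc_swap P Q hPQ _ (P : ℕ) (by omega)] at e3 e4
    rw [← hPQ] at e1 e2 e3 e4
    rw [← Cc_pos, ← Cc_pos] at hc
    have := Cc_le_one f hf P
    have := Cc_le_one f hf Q
    have := Cc_le_one h hh P
    have := Cc_le_one h hh Q
    have := hle P
    have := hle Q
    have := hle (Q+1)
    omega
  · rw [Nc_swap P Q hPQ h c hcQ, Nc_swap P Q hPQ f c hcQ]
    exact ⟨hle c, hle c⟩

lemma Dm_ninj {k : ℕ} (e : Fin k → Fin n) (G : Matrix (Fin n) (Fin n) K) (f : Fin k → Fin n)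
    (hf : ¬ Function.Injective f) : Dm e G f = 0 := by
  unfold Function.Injective at hf
  push Not at hf
  obtain ⟨a, b, hab, hne⟩ := hf
  unfold Dm
  refine Matrix.det_zero_of_column_eq hne ?_
  intro c
  simp [hab]

lemma mul_sdot_apply (P Q : Fin n) (hPQ : (Q : ℕ) = P + 1) (G : Matrix (Fin n) (Fin n) K)
    (x y : Fin n) :
    (G * sdot (n := n) (K := K) (Q : ℕ)) x y = (if y = P then -1 else 1) * G x (Equiv.swap P Q y) := by
  rw [Matrix.mul_apply, Finset.sum_eq_single (Equiv.swap P Q y)]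
  · rw [mul_comm]
    congr 1
    simp only [sdot, Matrix.of_apply, swap_val, Fin.ext_iff]
    split_ifs <;> first | rfl | omega
  · intro z _ hz
    have hz' : (z : ℕ) ≠ (Equiv.swap P Q y : Fin n) := fun h => hz (Fin.ext h)
    rw [swap_val] at hz'
    have : (sdot (n := n) (K := K) (Q : ℕ)) z y = 0 := by
      simp only [sdot, Matrix.of_apply, Fin.ext_iff]
      split_ifs at hz' ⊢ <;> first | rfl | omega
    rw [this, mul_zero]
  · simp

lemma mul_xmat_apply (P Q : Fin n) (hPQ : (Q : ℕ) = P + 1) (G : Matrix (Fin n) (Fin n) K)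
    (t : K) (x y : Fin n) :
    (G * xmat (n := n) (K := K) (Q : ℕ) t) x y = G x y + (if y = Q then t * G x P else 0) := by
  have : (xmat (n := n) (K := K) (Q : ℕ) t : Matrix (Fin n) (Fin n) K) = 1 + Matrix.single P Q t := by
    ext a b
    simp only [xmat, Matrix.of_apply, Matrix.add_apply, Matrix.one_apply, Matrix.single_apply,
      Fin.ext_iff]
    split_ifs <;> first | omega | simp
  rw [this, mul_add, mul_one, Matrix.add_apply]
  congr 1
  split_ifs with h
  · subst h
    rw [Matrix.mul_single_apply_same, mul_comm]
  · rw [Matrix.mul_single_apply_of_ne]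
    exact fun h' => h h'

lemma Dm_sdot {k : ℕ} (P Q : Fin n) (hPQ : (Q : ℕ) = P + 1) (e : Fin k → Fin n)
    (G : Matrix (Fin n) (Fin n) K) (f : Fin k → Fin n) :
    Dm e (G * sdot (n := n) (K := K) (Q : ℕ)) f =
      (∏ b, if f b = P then (-1 : K) else 1) * Dm e G (Equiv.swap P Q ∘ f) := by
  unfold Dm
  rw [← Matrix.det_mul_row]
  congr 1
  ext a b
  simp only [Matrix.of_apply, mul_sdot_apply P Q hPQ, Function.comp]

lemma Dm_xmat_not {k : ℕ} (P Q : Fin n) (hPQ : (Q : ℕ) = P + 1) (e : Fin k → Fin n)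
    (G : Matrix (Fin n) (Fin n) K) (t : K) (f : Fin k → Fin n) (hf : ∀ a, f a ≠ Q) :
    Dm e (G * xmat (n := n) (K := K) (Q : ℕ) t) f = Dm e G f := by
  unfold Dm
  congr 1
  ext a b
  simp only [Matrix.of_apply, mul_xmat_apply P Q hPQ, hf, if_false, add_zero]

lemma Dm_xmat {k : ℕ} (P Q : Fin n) (hPQ : (Q : ℕ) = P + 1) (e : Fin k → Fin n)
    (G : Matrix (Fin n) (Fin n) K) (t : K) (f : Fin k → Fin n) (hf : Function.Injective f)
    (a : Fin k) (ha : f a = Q) :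
    Dm e (G * xmat (n := n) (K := K) (Q : ℕ) t) f = Dm e G f + t * Dm e G (Function.update f a P) := by
  unfold Dm
  have h1 : (Matrix.of fun x b : Fin k => (G * xmat (n := n) (K := K) (Q : ℕ) t) (e x) (f b)) =
    (Matrix.of fun x b : Fin k => G (e x) (f b)).updateCol a
      ((fun x => G (e x) (f a)) + t • (fun x => G (e x) P)) := by
    ext x b
    rw [Matrix.updateCol_apply]
    simp only [Matrix.of_apply, mul_xmat_apply P Q hPQ]
    by_cases hb : b = a
    · subst hb
      simp [ha]
    · have : f b ≠ Q := fun h => hb (hf (h.trans ha.symm))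
      simp [hb, this]
  rw [h1, Matrix.det_updateCol_add, Matrix.det_updateCol_smul]
  congr 2
  · congr 1
    ext x b
    rw [Matrix.updateCol_apply]
    by_cases hb : b = a
    · subst hb; simp
    · simp [hb]
  · congr 1
    ext x b
    rw [Matrix.updateCol_apply]
    by_cases hb : b = a
    · subst hb; simp
    · simp [hb]

lemma update_eq_swap {k : ℕ} (P Q : Fin n) (f : Fin k → Fin n) (hf : Function.Injective f)
    (a : Fin k) (ha : f a = Q) (hP : ∀ b, f b ≠ P) :
    Function.update f a P = Equiv.swap P Q ∘ f := by
  ext b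
  by_cases hb : b = a
  · subst hb; simp [ha]
  · have : f b ≠ Q := fun h => hb (hf (h.trans ha.symm))
    simp [hb, Equiv.swap_apply_of_ne_of_ne (hP b) this]

lemma update_ninj {k : ℕ} (P Q : Fin n) (hPQ : (Q : ℕ) = P + 1) (f : Fin k → Fin n)
    (a : Fin k) (ha : f a = Q) (b : Fin k) (hb : f b = P) :
    ¬ Function.Injective (Function.update f a P) := by
  have hne : b ≠ a := by
    rintro rfl
    rw [ha] at hb
    have := congrArg Fin.val hb
    omega
  intro h
  apply hne
  apply h
  simp [hne, hb]

/-- support invariant -/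
def Inv1 {k : ℕ} (e : Fin k → Fin n) (G : Matrix (Fin n) (Fin n) K) (h : Fin k → Fin n) : Prop :=
  ∀ f, Dm e G f ≠ 0 → ∀ c, Nc h c ≤ Nc f c

def Inv2 {k : ℕ} (e : Fin k → Fin n) (G : Matrix (Fin n) (Fin n) K) (h : Fin k → Fin n)
    (c : K) : Prop :=
  ∀ f, StrictMono f → Set.range f = Set.range h → Dm e G f = c

lemma inv1_sdot {k : ℕ} (P Q : Fin n) (hPQ : (Q : ℕ) = P + 1) (e : Fin k → Fin n)
    (G : Matrix (Fin n) (Fin n) K) (h : Fin k → Fin n)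
    (hc : (∃ a, h a = Q) → ∃ a, h a = P) (hh : Function.Injective h) (H : Inv1 e G h) :
    Inv1 e (G * sdot (n := n) (K := K) (Q : ℕ)) (Equiv.swap P Q ∘ h) := by
  intro f hf c
  rw [Dm_sdot P Q hPQ] at hf
  have h1 := right_ne_zero_of_mul hf
  have hinj : Function.Injective (Equiv.swap P Q ∘ f) := by
    by_contra h2
    exact h1 (Dm_ninj _ _ _ h2)
  have := (gale_step P Q hPQ _ h hinj hc hh (H _ h1) c).2
  have e1 : Equiv.swap P Q ∘ (Equiv.swap P Q ∘ f) = f := by ext; simp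
  rwa [e1] at this

lemma inv1_xmat {k : ℕ} (P Q : Fin n) (hPQ : (Q : ℕ) = P + 1) (e : Fin k → Fin n)
    (G : Matrix (Fin n) (Fin n) K) (t : K) (h : Fin k → Fin n)
    (hc : (∃ a, h a = Q) → ∃ a, h a = P) (hh : Function.Injective h) (H : Inv1 e G h) :
    Inv1 e (G * xmat (n := n) (K := K) (Q : ℕ) t) (Equiv.swap P Q ∘ h) := by
  intro f hf c
  have hinj : Function.Injective f := by
    by_contra h2
    exact hf (Dm_ninj _ _ _ h2)
  by_cases h0 : Dm e G f = 0
  · by_cases hQ : ∃ a, f a = Q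
    · obtain ⟨a, ha⟩ := hQ
      rw [Dm_xmat P Q hPQ e G t f hinj a ha, h0, zero_add] at hf
      have h1 := right_ne_zero_of_mul hf
      have hP : ∀ b, f b ≠ P := by
        intro b hb
        exact h1 (Dm_ninj _ _ _ (update_ninj P Q hPQ f a ha b hb))
      rw [update_eq_swap P Q f hinj a ha hP] at h1
      have := (gale_step P Q hPQ _ h ((Equiv.swap P Q).injective.comp hinj) hc hh (H _ h1) c).2
      have e1 : Equiv.swap P Q ∘ (Equiv.swap P Q ∘ f) = f := by ext; simp
      rwa [e1] at this
    · push Not at hQ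
      rw [Dm_xmat_not P Q hPQ e G t f hQ] at hf
      exact absurd h0 hf
  · exact (gale_step P Q hPQ _ h hinj hc hh (H _ h0) c).1

lemma range_swap {k : ℕ} (P Q : Fin n) (f h : Fin k → Fin n)
    (hr : Set.range f = Set.range (Equiv.swap P Q ∘ h)) :
    Set.range (Equiv.swap P Q ∘ f) = Set.range h := by
  rw [Set.range_comp, hr, ← Set.range_comp]
  congr 1
  ext; simp

lemma mem_range_swap {k : ℕ} (P Q x : Fin n) (f h : Fin k → Fin n)
    (hr : Set.range f = Set.range (Equiv.swap P Q ∘ h)) :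
    (∃ a, f a = x) ↔ ∃ a, h a = Equiv.swap P Q x := by
  have : x ∈ Set.range f ↔ x ∈ Set.range (Equiv.swap P Q ∘ h) := by rw [hr]
  simp only [Set.mem_range, Function.comp] at this
  rw [this]
  constructor
  · rintro ⟨a, ha⟩; exact ⟨a, by rw [← ha]; simp⟩
  · rintro ⟨a, ha⟩; exact ⟨a, by rw [ha]; simp⟩

lemma strictMono_swap {k : ℕ} (P Q : Fin n) (hPQ : (Q : ℕ) = P + 1) (f : Fin k → Fin n)
    (hf : StrictMono f) (hP : ∀ a, f a ≠ P) : StrictMono (Equiv.swap P Q ∘ f) := by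
  intro a b hab
  have h1 := hf hab
  have h2 : (f a : ℕ) ≠ P := fun h => hP a (Fin.ext h)
  have h3 : (f b : ℕ) ≠ P := fun h => hP b (Fin.ext h)
  rw [Fin.lt_def] at h1 ⊢
  simp only [Function.comp, swap_val]
  split_ifs <;> omega

lemma range_eq_of_iff {k : ℕ} (P Q : Fin n) (f h : Fin k → Fin n)
    (hr : Set.range f = Set.range (Equiv.swap P Q ∘ h))
    (hb : (∃ a, h a = P) ↔ (∃ a, h a = Q)) : Set.range f = Set.range h := by
  ext x
  simp only [Set.mem_range]
  rw [mem_range_swap P Q x f h hr]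
  by_cases h1 : x = P
  · subst h1; simp [hb]
  by_cases h2 : x = Q
  · subst h2; simp [hb]
  rw [Equiv.swap_apply_of_ne_of_ne h1 h2]

lemma Dm_swap_cols {k : ℕ} (P Q : Fin n) (hPQ : (Q : ℕ) = P + 1) (e : Fin k → Fin n)
    (G : Matrix (Fin n) (Fin n) K) (f : Fin k → Fin n) (hf : Function.Injective f)
    (a b : Fin k) (ha : f a = P) (hb : f b = Q) :
    Dm e G (Equiv.swap P Q ∘ f) = - Dm e G f := by
  have hne : a ≠ b := by
    rintro rfl
    rw [ha] at hb
    have := congrArg Fin.val hb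
    omega
  have : Equiv.swap P Q ∘ f = f ∘ Equiv.swap a b := by
    rw [← ha, ← hb]
    ext x
    rw [Function.comp, Function.comp]
    rw [hf.swap_apply]
  rw [this]
  have h2 := Matrix.det_permute' (Equiv.swap a b) (Matrix.of fun x b : Fin k => G (e x) (f b))
  rw [Equiv.Perm.sign_swap hne] at h2
  simp only [Units.val_neg, Units.val_one, Int.cast_neg, Int.cast_one, neg_mul, one_mul] at h2
  exact h2

lemma inv2_sdot {k : ℕ} (P Q : Fin n) (hPQ : (Q : ℕ) = P + 1) (e : Fin k → Fin n)
    (G : Matrix (Fin n) (Fin n) K) (h : Fin k → Fin n)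
    (hc : (∃ a, h a = Q) → ∃ a, h a = P) (c : K) (H : Inv2 e G h c) :
    Inv2 e (G * sdot (n := n) (K := K) (Q : ℕ)) (Equiv.swap P Q ∘ h) c := by
  intro f hf hr
  rw [Dm_sdot P Q hPQ]
  have mP := mem_range_swap P Q P f h hr
  have mQ := mem_range_swap P Q Q f h hr
  rw [Equiv.swap_apply_left] at mP
  rw [Equiv.swap_apply_right] at mQ
  by_cases hP : ∃ a, f a = P
  · obtain ⟨b, hb⟩ := mQ.2 (hc (mP.1 hP))
    have hr' : Set.range f = Set.range h :=
      range_eq_of_iff P Q f h hr ⟨fun _ => mP.1 hP, hc⟩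
    obtain ⟨a, ha⟩ := hP
    rw [Dm_swap_cols P Q hPQ e G f hf.injective a b ha hb, H f hf hr',
      Finset.prod_eq_single a]
    · simp [ha]
    · intro x _ hx
      rw [if_neg]
      intro h
      exact hx (hf.injective (h.trans ha.symm))
    · simp
  · push Not at hP
    rw [H _ (strictMono_swap P Q hPQ f hf hP) (range_swap P Q f h hr)]
    simp [hP]

lemma inv2_xmat {k : ℕ} (P Q : Fin n) (hPQ : (Q : ℕ) = P + 1) (e : Fin k → Fin n)
    (G : Matrix (Fin n) (Fin n) K) (t : K) (h : Fin k → Fin n)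
    (hc : (∃ a, h a = Q) → ∃ a, h a = P) (hh : Function.Injective h)
    (c : K) (H1 : Inv1 e G h) (H : Inv2 e G h c) :
    Inv2 e (G * xmat (n := n) (K := K) (Q : ℕ) t) (Equiv.swap P Q ∘ h)
      (c * t ^ ((if ∃ a, h a = P then (1 : ℤ) else 0) - (if ∃ a, h a = Q then (1 : ℤ) else 0))) := by
  intro f hf hr
  have mP := mem_range_swap P Q P f h hr
  have mQ := mem_range_swap P Q Q f h hr
  rw [Equiv.swap_apply_left] at mP
  rw [Equiv.swap_apply_right] at mQ
  by_cases hP : ∃ a, h a = P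
  · obtain ⟨b, hb⟩ := mQ.2 hP
    rw [Dm_xmat P Q hPQ e G t f hf.injective b hb]
    by_cases hQ : ∃ a, h a = Q
    · have hr' : Set.range f = Set.range h :=
        range_eq_of_iff P Q f h hr ⟨fun _ => hQ, hc⟩
      obtain ⟨a, ha⟩ := mP.2 hQ
      rw [Dm_ninj _ _ _ (update_ninj P Q hPQ f b hb a ha), H f hf hr']
      simp [hP, hQ]
    · have hP' : ∀ a, f a ≠ P := fun a ha => hQ (mP.1 ⟨a, ha⟩)
      rw [update_eq_swap P Q f hf.injective b hb hP',
        H _ (strictMono_swap P Q hPQ f hf hP') (range_swap P Q f h hr)]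
      have h0 : Dm e G f = 0 := by
        by_contra h0
        have h1 := H1 f h0 Q
        have hh2 : Nc h Q = Nc h P + Cc h P := by rw [hPQ]; exact Nc_succ h P
        have hf2 : Nc f Q = Nc f P + Cc f P := by rw [hPQ]; exact Nc_succ f P
        have hp := (Cc_pos h P).2 hP
        have hfp : Cc f P = 0 := by
          by_contra h3
          obtain ⟨a, ha⟩ := (Cc_pos f P).1 (Nat.pos_of_ne_zero h3)
          exact hP' a ha
        have h4 : Nc f P = Nc h P := by
          have e1 := Nc_swap P Q hPQ f P (by omega)
          rw [← e1]
          unfold Nc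
          have h5 : ∀ g : Fin k → Fin n, Function.Injective g →
              (univ.filter fun a => (g a : ℕ) < P).card =
              (Set.range g ∩ {x | (x : ℕ) < P}).ncard := by
            intro g hg
            rw [← Set.ncard_coe_finset, ← Set.ncard_image_of_injective _ hg]
            congr 1
            ext x
            simp only [Set.mem_image, Set.mem_inter_iff, Set.mem_range, Set.mem_setOf_eq,
              coe_filter, mem_univ, true_and]
            constructor
            · rintro ⟨a, h1, rfl⟩; exact ⟨⟨a, rfl⟩, h1⟩
            · rintro ⟨⟨a, rfl⟩, h1⟩; exact ⟨a, h1, rfl⟩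
          rw [h5 _ ((Equiv.swap P Q).injective.comp hf.injective), h5 _ hh,
            range_swap P Q f h hr]
        omega
      rw [h0]
      simp [hP, hQ, mul_comm]
  · have hQ : ¬ ∃ a, h a = Q := fun h => hP (hc h)
    have hfQ : ∀ a, f a ≠ Q := fun a ha => hP (mQ.1 ⟨a, ha⟩)
    have hr' : Set.range f = Set.range h :=
      range_eq_of_iff P Q f h hr ⟨fun h => absurd h hP, hc⟩
    rw [Dm_xmat_not P Q hPQ e G t f hfQ, H f hf hr']
    simp [hP, hQ]

lemma strictMono_range_eq {k : ℕ} (f g : Fin k → Fin n) (hf : StrictMono f) (hg : StrictMono g)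
    (h : Set.range f = Set.range g) : f = g :=
  (StrictMono.range_inj hf hg).1 h

lemma inv1_one {k : ℕ} (e : Fin k → Fin n) (he : StrictMono e) :
    Inv1 e (1 : Matrix (Fin n) (Fin n) K) e := by
  intro f hf c
  have h1 : ∀ a, ∃ b, f b = e a := by
    by_contra h
    push Not at h
    obtain ⟨a, ha⟩ := h
    apply hf
    unfold Dm
    apply Matrix.det_eq_zero_of_row_eq_zero a
    intro b
    simp only [Matrix.of_apply]
    exact Matrix.one_apply_ne (ha b).symm
  choose g hg using h1
  unfold Nc
  refine Finset.card_le_card_of_injOn g ?_ ?_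
  · intro a ha
    simpa [hg] using ha
  · intro a _ b _ hab
    apply he.injective
    rw [← hg a, ← hg b, hab]

lemma inv2_one {k : ℕ} (e : Fin k → Fin n) (he : StrictMono e) :
    Inv2 e (1 : Matrix (Fin n) (Fin n) K) e 1 := by
  intro f hf hr
  rw [strictMono_range_eq f e hf he hr]
  unfold Dm
  rw [← Matrix.det_one (n := Fin k) (R := K)]
  congr 1
  ext a b
  simp [Matrix.one_apply, he.injective.eq_iff]

lemma minor_eq {k : ℕ} (e f : Fin k → Fin n) (he : StrictMono e) (hf : StrictMono f)
    (I J : Finset (Fin n)) (hI : Set.range e = I) (hJ : Set.range f = J)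
    (G : Matrix (Fin n) (Fin n) K) : minor G I J = Dm e G f := by
  have cI : I.card = k := by
    rw [← Set.ncard_coe_finset, ← hI, ← Set.image_univ, Set.ncard_image_of_injective _ he.injective]
    simp
  have cJ : J.card = k := by
    rw [← Set.ncard_coe_finset, ← hJ, ← Set.image_univ, Set.ncard_image_of_injective _ hf.injective]
    simp
  subst cI
  unfold minor Dm
  rw [dif_pos cJ.symm]
  have h1 := Finset.orderEmbOfFin_unique (s := I) rfl (f := e)
    (fun x => by rw [← Finset.mem_coe, ← hI]; exact ⟨x, rfl⟩) he
  have h2 := Finset.orderEmbOfFin_unique (s := J) cJ (f := f)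
    (fun x => by rw [← Finset.mem_coe, ← hJ]; exact ⟨x, rfl⟩) hf
  rw [h1, h2]

lemma len_swap (P Q : Fin n) (hPQ : (Q : ℕ) = P + 1) (p : Equiv.Perm (Fin n)) :
    len (p * Equiv.swap P Q) ≤ len p + 1 ∧
      (p Q < p P → len (p * Equiv.swap P Q) ≤ len p) := by
  have key : ((univ.filter fun x : Fin n × Fin n =>
      x.1 < x.2 ∧ (p * Equiv.swap P Q) x.2 < (p * Equiv.swap P Q) x.1).erase (P, Q)).card
      ≤ len p := by
    unfold len
    refine Finset.card_le_card_of_injOn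
      (fun x => (Equiv.swap P Q x.1, Equiv.swap P Q x.2)) ?_ ?_
    · rintro ⟨a, b⟩ h
      rw [Finset.mem_coe, Finset.mem_erase, Finset.mem_filter] at h
      rw [Finset.mem_coe, Finset.mem_filter]
      obtain ⟨h2, -, h1, h3⟩ := h
      refine ⟨Finset.mem_univ _, ?_, h3⟩
      rw [ne_eq, Prod.mk.injEq] at h2
      simp only at h1 ⊢
      rw [Fin.lt_def] at h1 ⊢
      rw [Fin.ext_iff, Fin.ext_iff] at h2
      rw [swap_val, swap_val]
      split_ifs <;> omega
    · rintro ⟨a, b⟩ _ ⟨c, d⟩ _ h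
      simpa using h
  constructor
  · refine le_trans ?_ (Nat.add_le_add_right key 1)
    have := Finset.pred_card_le_card_erase (s := univ.filter fun x : Fin n × Fin n =>
      x.1 < x.2 ∧ (p * Equiv.swap P Q) x.2 < (p * Equiv.swap P Q) x.1) (a := (P, Q))
    rw [len]
    omega
  · intro h
    rw [Finset.erase_eq_of_notMem] at key
    · exact key
    · intro hmem
      have h3 := (Finset.mem_filter.1 hmem).2.2
      simp only [Equiv.Perm.mul_apply, Equiv.swap_apply_left, Equiv.swap_apply_right] at h3
      exact absurd h3 (not_lt.2 h.le)

lemma len_one : len (1 : Equiv.Perm (Fin n)) = 0 := by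
  unfold len
  rw [Finset.card_eq_zero, Finset.filter_eq_empty_iff]
  rintro ⟨a, b⟩ _ ⟨h1, h2⟩
  exact absurd h1 (not_lt.2 (le_of_lt h2))

lemma take_ofFn_prod {M : Type*} [Monoid M] (F : Fin m → M) (r : ℕ) (hr : r < m) :
    ((List.ofFn F).take (r + 1)).prod = ((List.ofFn F).take r).prod * F ⟨r, hr⟩ := by
  rw [List.prod_take_succ _ _ (by simpa using hr)]
  simp

lemma sperm_eq (i : ℕ) (h1 : 1 ≤ i) (h2 : i < n) :
    ∃ P Q : Fin n, (Q : ℕ) = P + 1 ∧ (Q : ℕ) = i ∧ sperm n i = Equiv.swap P Q := by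
  refine ⟨⟨i - 1, by omega⟩, ⟨i, h2⟩, by simp; omega, rfl, ?_⟩
  unfold sperm
  rw [dif_pos h2]

lemma len_take (ii : Fin m → ℕ) (hii : ∀ r, 1 ≤ ii r ∧ ii r < n) (d : ℕ) :
    ∀ r, r + d ≤ m → len (((sPermList n ii).take (r + d)).prod) ≤
      len (((sPermList n ii).take r).prod) + d := by
  induction d with
  | zero => intro r _; simp
  | succ d ih =>
    intro r hr
    have h1 := ih r (by omega)
    rw [← add_assoc]
    unfold sPermList at *
    rw [take_ofFn_prod _ (r + d) (by omega)]
    obtain ⟨P, Q, hPQ, -, hs⟩ := sperm_eq (n := n) _ (hii ⟨r + d, by omega⟩).1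
      (hii ⟨r + d, by omega⟩).2
    rw [hs]
    have := (len_swap P Q hPQ ((List.take (r + d) (List.ofFn fun r => sperm n (ii r))).prod)).1
    omega

lemma main_inv (ii : Fin m → ℕ) (hii : ∀ r, 1 ≤ ii r ∧ ii r < n)
    (hred : len ((sPermList n ii).prod) = m) (v : Equiv.Perm (Fin n)) (t : Fin m → K)
    (i : ℕ) (hi : i ≤ n) (r : ℕ) (hr : r ≤ m) :
    Inv1 (Fin.castLE hi) (((mrgList ii v t).take r).prod)
      (fun a => (((sPermList n ii).take r).prod)⁻¹ (Fin.castLE hi a)) ∧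
    Inv2 (Fin.castLE hi) (((mrgList ii v t).take r).prod)
      (fun a => (((sPermList n ii).take r).prod)⁻¹ (Fin.castLE hi a))
      (∏ r ∈ univ.filter (fun q : Fin m => inJ ii v q ∧ (q : ℕ) < r),
      t r ^
        (((if ∃ j : Fin n, (j : ℕ) + 1 = ii r ∧
              ((((sPermList n ii).take (r : ℕ)).prod) j : ℕ) < i
           then (1 : ℤ) else 0)
         - (if ∃ j : Fin n, (j : ℕ) = ii r ∧
              ((((sPermList n ii).take (r : ℕ)).prod) j : ℕ) < i
           then (1 : ℤ) else 0)))) := by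
  induction r with
  | zero =>
    have he : StrictMono (Fin.castLE hi) := Fin.strictMono_castLE hi
    constructor
    · simpa using inv1_one (K := K) _ he
    · simpa using inv2_one (K := K) _ he
  | succ r ih =>
    obtain ⟨H1, H2⟩ := ih (by omega)
    have hr' : r < m := hr
    obtain ⟨P, Q, hPQ, hQ, hs⟩ := sperm_eq (n := n) _ (hii ⟨r, hr'⟩).1 (hii ⟨r, hr'⟩).2
    have eS : ((sPermList n ii).take (r + 1)).prod =
        ((sPermList n ii).take r).prod * Equiv.swap P Q := by
      unfold sPermList
      rw [take_ofFn_prod _ r hr', hs]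
    have eG : ((mrgList ii v t).take (r + 1)).prod = ((mrgList ii v t).take r).prod *
        (if inJ ii v ⟨r, hr'⟩ then xmat (n := n) (K := K) (Q : ℕ) (t ⟨r, hr'⟩) else sdot (n := n) (K := K) (Q : ℕ)) := by
      unfold mrgList
      rw [take_ofFn_prod _ r hr', hQ]
    have hlt : ((sPermList n ii).take r).prod P < ((sPermList n ii).take r).prod Q := by
      by_contra hcon
      have hne : ((sPermList n ii).take r).prod P ≠ ((sPermList n ii).take r).prod Q := by
        intro h
        have := congrArg Fin.val (Equiv.injective _ h)
        omega
      have h1 := (len_swap P Q hPQ ((sPermList n ii).take r).prod).2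
        (lt_of_le_of_ne (not_lt.1 hcon) hne.symm)
      rw [← eS] at h1
      have h2 := len_take ii hii r 0 (by omega)
      have h3 := len_take ii hii (m - (r + 1)) (r + 1) (by omega)
      have h4 : r + 1 + (m - (r + 1)) = m := by omega
      rw [h4] at h3
      have h5 : (sPermList n ii).take m = sPermList n ii := by
        apply List.take_of_length_le
        simp [sPermList]
      rw [h5, hred] at h3
      simp only [zero_add, List.take_zero, List.prod_nil, len_one] at h2
      omega
    set p := ((sPermList n ii).take r).prod with hp
    set h : Fin i → Fin n := fun a => p⁻¹ (Fin.castLE hi a) with hh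
    have hinj : Function.Injective h := by
      intro a b hab
      exact (Fin.strictMono_castLE hi).injective (Equiv.injective _ hab)
    have hmem : ∀ x, (∃ a, h a = x) ↔ (p x : ℕ) < i := by
      intro x
      constructor
      · rintro ⟨a, rfl⟩
        simp [hh]
      · intro hx
        refine ⟨⟨p x, hx⟩, ?_⟩
        simp only [hh]
        rw [Equiv.Perm.inv_eq_iff_eq]
        ext; simp
    have hc : (∃ a, h a = Q) → ∃ a, h a = P := by
      rw [hmem, hmem]
      intro h1
      rw [Fin.lt_def] at hlt
      omega
    have eh : (fun a => (((sPermList n ii).take (r + 1)).prod)⁻¹ (Fin.castLE hi a)) =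
        Equiv.swap P Q ∘ h := by
      rw [eS]
      ext a
      simp [hh]
    rw [eh, eG]
    have hset1 : inJ ii v ⟨r, hr'⟩ → (univ.filter (fun q : Fin m => inJ ii v q ∧ (q : ℕ) < r + 1))
        = insert ⟨r, hr'⟩ (univ.filter (fun q : Fin m => inJ ii v q ∧ (q : ℕ) < r)) := by
      intro hJ
      ext q
      simp only [mem_filter, mem_univ, true_and, mem_insert, Fin.ext_iff]
      constructor
      · rintro ⟨h1, h2⟩
        by_cases h3 : (q : ℕ) = r
        · exact Or.inl h3
        · exact Or.inr ⟨h1, by omega⟩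
      · rintro (h1 | h1)
        · have : q = ⟨r, hr'⟩ := Fin.ext h1
          exact ⟨this ▸ hJ, by omega⟩
        · exact ⟨h1.1, by omega⟩
    have hset2 : ¬ inJ ii v ⟨r, hr'⟩ → (univ.filter (fun q : Fin m => inJ ii v q ∧ (q : ℕ) < r + 1))
        = (univ.filter (fun q : Fin m => inJ ii v q ∧ (q : ℕ) < r)) := by
      intro hJ
      ext q
      simp only [mem_filter, mem_univ, true_and]
      constructor
      · rintro ⟨h1, h2⟩
        refine ⟨h1, ?_⟩
        by_contra h3
        have : q = ⟨r, hr'⟩ := Fin.ext (by simp; omega)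
        exact hJ (this ▸ h1)
      · rintro h1
        exact ⟨h1.1, by omega⟩
    by_cases hJ : inJ ii v ⟨r, hr'⟩
    · rw [if_pos hJ, hset1 hJ, Finset.prod_insert (by simp)]
      refine ⟨inv1_xmat P Q hPQ _ _ _ h hc hinj H1, ?_⟩
      have := inv2_xmat P Q hPQ _ _ (t ⟨r, hr'⟩) h hc hinj _ H1 H2
      rw [mul_comm] at this
      have q1 : (∃ j : Fin n, (j : ℕ) + 1 = ii ⟨r, hr'⟩ ∧ (p j : ℕ) < i) ↔ ∃ a, h a = P := by
        rw [hmem]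
        constructor
        · rintro ⟨j, h1, h2⟩
          have : j = P := Fin.ext (by omega)
          exact this ▸ h2
        · intro h1
          exact ⟨P, by omega, h1⟩
      have q2 : (∃ j : Fin n, (j : ℕ) = ii ⟨r, hr'⟩ ∧ (p j : ℕ) < i) ↔ ∃ a, h a = Q := by
        rw [hmem]
        constructor
        · rintro ⟨j, h1, h2⟩
          have : j = Q := Fin.ext (by omega)
          exact this ▸ h2
        · intro h1
          exact ⟨Q, by omega, h1⟩
      simp only [← hp, q1, q2]
      exact this
    · rw [if_neg hJ, hset2 hJ]
      exact ⟨inv1_sdot P Q hPQ _ _ h hc hinj H1, inv2_sdot P Q hPQ _ _ h hc _ H2⟩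

/-- the minors `Δ^{{1..i}}_{w⁻¹({1..i})}(g)` of a Marsh–Rietsch element
(Lemma 7.7, type A). The 1-based condition `p_r(i_r) ≤ i` is expressed as
`∃ j, (j:ℕ)+1 = i_r ∧ (p_r j : ℕ) < i` in 0-based indexing. -/
theorem statement_13 {n m : ℕ} (hn : 1 ≤ n) (ii : Fin m → ℕ)
    (hii : ∀ r, 1 ≤ ii r ∧ ii r < n)
    (w : Equiv.Perm (Fin n)) (hw : w = (sPermList n ii).prod) (hred : len w = m)
    (v : Equiv.Perm (Fin n)) (hv0 : vseq ii v m = 1)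
    (t : Fin m → ℂ) (ht : ∀ r, inJ ii v r → t r ≠ 0)
    (i : ℕ) (hi1 : 1 ≤ i) (hi2 : i ≤ n) :
    minor (mrg ii v t)
      (univ.filter fun j : Fin n => (j : ℕ) < i)
      ((univ.filter fun j : Fin n => (j : ℕ) < i).image ⇑w⁻¹)
    =
    ∏ r ∈ univ.filter (fun r : Fin m => inJ ii v r),
      t r ^
        (((if ∃ j : Fin n, (j : ℕ) + 1 = ii r ∧
              ((((sPermList n ii).take (r : ℕ)).prod) j : ℕ) < i
           then (1 : ℤ) else 0)
         - (if ∃ j : Fin n, (j : ℕ) = ii r ∧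
              ((((sPermList n ii).take (r : ℕ)).prod) j : ℕ) < i
           then (1 : ℤ) else 0))) := by
  have hfull : (sPermList n ii).take m = sPermList n ii := by
    apply List.take_of_length_le
    simp [sPermList]
  have hfull2 : (mrgList ii v t).take m = mrgList ii v t := by
    apply List.take_of_length_le
    simp [mrgList]
  have H := (main_inv ii hii (hw ▸ hred) v t i hi2 m le_rfl).2
  rw [hfull, hfull2, ← hw] at H
  have hset : (univ.filter (fun q : Fin m => inJ ii v q ∧ (q : ℕ) < m)) =
      univ.filter (fun q : Fin m => inJ ii v q) := by
    ext q
    simp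
  rw [hset] at H
  set J := (univ.filter fun j : Fin n => (j : ℕ) < i).image ⇑w⁻¹ with hJ
  have hI : Set.range (Fin.castLE hi2) = ((univ.filter fun j : Fin n => (j : ℕ) < i : Finset (Fin n)) : Set (Fin n)) := by
    ext x
    simp
  have cI : (univ.filter fun j : Fin n => (j : ℕ) < i).card = i := by
    rw [← Set.ncard_coe_finset, ← hI, ← Set.image_univ,
      Set.ncard_image_of_injective _ (Fin.strictMono_castLE hi2).injective]
    simp
  have cJ : J.card = i := by
    rw [hJ, Finset.card_image_of_injective _ (Equiv.injective _), cI]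
  rw [minor_eq (Fin.castLE hi2) (J.orderEmbOfFin cJ) (Fin.strictMono_castLE hi2)
    (J.orderEmbOfFin cJ).strictMono _ J hI (Finset.range_orderEmbOfFin J cJ)]
  unfold mrg
  apply H _ (J.orderEmbOfFin cJ).strictMono
  rw [Finset.range_orderEmbOfFin, hJ, Finset.coe_image, ← hI, ← Set.range_comp]
  rfl

end
end Paper
end

section
/- In the Marsh–Rietsch setup over ℂ with all parameters t_r ≠ 0: the matrix gᵀ·ẇ admits a UDL factorization; set y⃗ := [gᵀẇ]_L^+. For each r ∈ {1,…,m}: the matrix g_mᵀ·g_{m−1}ᵀ···g_rᵀ·ṡ_{i_r}·ṡ_{i_{r+1}}···ṡ_{i_m} admits a UDL factorization, with unipotent upper factor y^{(r)}, and there exists h ∈ N with u̇·h·u̇⁻¹ ∈ N, where u := s_{i_r}∘s_{i_{r+1}}∘···∘s_{i_m}, such that y⃗ = y^{(r)}·h. -/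
open Matrix Finset

namespace Paper

open scoped Classical

noncomputable section

variable {K : Type*} [Field K] {n m : ℕ}

abbrev Mt (n : ℕ) := Matrix (Fin n) (Fin n) ℂ

def Pat (R : Fin n → Fin n → Prop) (M : Mt n) : Prop := ∀ i j, M i j ≠ 0 → R i j

lemma Pat.mul {R : Fin n → Fin n → Prop} (hR : ∀ i j k, R i j → R j k → R i k)
    {A B : Mt n} (hA : Pat R A) (hB : Pat R B) : Pat R (A * B) := by
  intro i j h
  rw [Matrix.mul_apply] at h
  obtain ⟨k, -, hk⟩ := Finset.exists_ne_zero_of_sum_ne_zero h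
  exact hR i k j (hA _ _ (left_ne_zero_of_mul hk)) (hB _ _ (right_ne_zero_of_mul hk))

lemma Pat.mono {R R' : Fin n → Fin n → Prop} (hR : ∀ i j, R i j → R' i j)
    {A : Mt n} (hA : Pat R A) : Pat R' A := fun i j h => hR i j (hA i j h)

lemma Pat.diag_mul {R : Fin n → Fin n → Prop} (hR : ∀ i j, R i j → R j i → i = j)
    {A B : Mt n} (hA : Pat R A) (hB : Pat R B) (i : Fin n) :
    (A * B) i i = A i i * B i i := by
  rw [Matrix.mul_apply]
  apply Finset.sum_eq_single i
  · intro k _ hk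
    by_contra h
    exact hk (hR i k (hA _ _ (left_ne_zero_of_mul h)) (hB _ _ (right_ne_zero_of_mul h))).symm
  · simp

lemma up_trans : ∀ i j k : Fin n, i ≤ j → j ≤ k → i ≤ k := fun _ _ _ => le_trans
lemma low_trans : ∀ i j k : Fin n, j ≤ i → k ≤ j → k ≤ i := fun _ _ _ h h' => le_trans h' h
lemma up_anti : ∀ i j : Fin n, i ≤ j → j ≤ i → i = j := fun _ _ => le_antisymm

def RN (σ : Equiv.Perm (Fin n)) (i j : Fin n) : Prop := i ≤ j ∧ σ i ≤ σ j
def RM (σ : Equiv.Perm (Fin n)) (i j : Fin n) : Prop := i ≤ j ∧ σ j ≤ σ i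

lemma RN_trans (σ : Equiv.Perm (Fin n)) : ∀ i j k, RN σ i j → RN σ j k → RN σ i k :=
  fun _ _ _ h h' => ⟨h.1.trans h'.1, h.2.trans h'.2⟩
lemma RM_trans (σ : Equiv.Perm (Fin n)) : ∀ i j k, RM σ i j → RM σ j k → RM σ i k :=
  fun _ _ _ h h' => ⟨h.1.trans h'.1, h'.2.trans h.2⟩

lemma isN_iff (M : Mt n) : IsN M ↔ (∀ i, M i i = 1) ∧ Pat (· ≤ ·) M := by
  refine and_congr Iff.rfl ⟨fun h i j hne => ?_, fun h i j hlt => ?_⟩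
  · by_contra hc; exact hne (h i j (not_le.1 hc))
  · by_contra hc; exact absurd (h i j hc) (not_le.2 hlt)

lemma isNm_iff (M : Mt n) : IsNm M ↔ (∀ i, M i i = 1) ∧ Pat (fun i j => j ≤ i) M := by
  refine and_congr Iff.rfl ⟨fun h i j hne => ?_, fun h i j hlt => ?_⟩
  · by_contra hc; exact hne (h i j (not_le.1 hc))
  · by_contra hc; exact absurd (h i j hc) (not_le.2 hlt)

lemma pat_up_iff (M : Mt n) : Pat (· ≤ ·) M ↔ M.BlockTriangular id := by
  refine ⟨fun h i j hlt => ?_, fun h i j hne => ?_⟩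
  · by_contra hc; exact absurd (h i j hc) (not_le.2 hlt)
  · by_contra hc; exact hne (h (not_le.1 hc))

lemma isN_det {M : Mt n} (h : IsN M) : M.det = 1 := by
  have h' := (isN_iff M).1 h
  rw [Matrix.det_of_upperTriangular ((pat_up_iff M).1 h'.2)]
  simp [h'.1]

lemma isNm_transpose {M : Mt n} (h : IsNm M) : IsN Mᵀ := ⟨h.1, fun i j hij => h.2 j i hij⟩

lemma isNm_det {M : Mt n} (h : IsNm M) : M.det = 1 := by
  rw [← Matrix.det_transpose]; exact isN_det (isNm_transpose h)

/-- transposed matrices of upper pattern inverse -/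
lemma pat_up_inv {M : Mt n} (h : Pat (· ≤ ·) M) (hd : M.det ≠ 0) : Pat (· ≤ ·) M⁻¹ := by
  rw [pat_up_iff] at h ⊢
  let _ := Matrix.invertibleOfIsUnitDet M (isUnit_iff_ne_zero.2 hd)
  exact Matrix.blockTriangular_inv_of_blockTriangular h

lemma pat_low_inv {M : Mt n} (h : Pat (fun i j => j ≤ i) M) (hd : M.det ≠ 0) :
    Pat (fun i j => j ≤ i) M⁻¹ := by
  have h1 : Pat (· ≤ ·) Mᵀ := fun i j hne => h j i hne
  have h2 := pat_up_inv h1 (by rwa [Matrix.det_transpose])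
  rw [← Matrix.transpose_nonsing_inv] at h2
  exact fun i j hne => h2 j i hne

lemma UL_unique {a L a' L' : Mt n} (ha : IsN a) (ha' : IsN a')
    (hL : Pat (fun i j => j ≤ i) L) (hL' : Pat (fun i j => j ≤ i) L')
    (hd : L.det ≠ 0) (h : a * L = a' * L') : a = a' := by
  have da := isN_det ha
  have da' := isN_det ha'
  rw [isN_iff] at ha ha'
  have u' : IsUnit a'.det := by simp [da']
  have uL : IsUnit L.det := isUnit_iff_ne_zero.2 hd
  have e : a'⁻¹ * a = L' * L⁻¹ := by
    calc a'⁻¹ * a = a'⁻¹ * (a * L) * L⁻¹ := by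
          rw [Matrix.mul_assoc, Matrix.mul_assoc a, Matrix.mul_nonsing_inv _ uL, Matrix.mul_one]
      _ = L' * L⁻¹ := by
          rw [h, ← Matrix.mul_assoc, Matrix.nonsing_inv_mul _ u', Matrix.one_mul]
  have pX : Pat (· ≤ ·) (a'⁻¹ * a) :=
    Pat.mul up_trans (pat_up_inv ha'.2 (by simp [da'])) ha.2
  have pX' : Pat (fun i j => j ≤ i) (a'⁻¹ * a) := by
    rw [e]
    exact Pat.mul (R := fun i j : Fin n => j ≤ i) low_trans hL' (pat_low_inv hL hd)
  have e2 : a' * (a'⁻¹ * a) = a := by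
    rw [← Matrix.mul_assoc, Matrix.mul_nonsing_inv _ u', Matrix.one_mul]
  have hX : a'⁻¹ * a = 1 := by
    ext i j
    by_cases hij : i = j
    · subst hij
      have := Pat.diag_mul up_anti ha'.2 pX i
      rw [e2, ha.1, ha'.1] at this
      simpa using this.symm
    · rw [Matrix.one_apply_ne hij]
      by_contra hc
      exact hij (le_antisymm (pX _ _ hc) (pX' _ _ hc))
  rw [hX, Matrix.mul_one] at e2
  exact e2.symm

lemma UDL_low {A a b c : Mt n} (h : UDL A a b c) :
    Pat (fun i j => j ≤ i) (b * c) ∧ (b * c).det ≠ 0 ∧ A = a * (b * c) := by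
  obtain ⟨-, hb, hc, e⟩ := h
  refine ⟨Pat.mul (R := fun i j : Fin n => j ≤ i) low_trans (fun i j hne => ?_) ((isNm_iff c).1 hc).2, ?_, ?_⟩
  · by_contra hcon
    exact hne (hb.2 i j (by rintro rfl; exact hcon le_rfl))
  · rw [Matrix.det_mul, hb.1, isNm_det hc]; simp
  · rw [e, Matrix.mul_assoc]

lemma UDL_of_low {A a L : Mt n} (ha : IsN a) (hL : Pat (fun i j => j ≤ i) L)
    (hA : A.det = 1) (e : A = a * L) : ∃ b c, UDL A a b c := by
  have dL : L.det = 1 := by rw [e, Matrix.det_mul, isN_det ha, one_mul] at hA; exact hA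
  have hLt : Pat (· ≤ ·) Lᵀ := fun i j hne => hL j i hne
  have dp : ∏ i, L i i = 1 := by
    have := Matrix.det_of_upperTriangular ((pat_up_iff _).1 hLt)
    rw [Matrix.det_transpose, dL] at this
    simpa using this.symm
  have hne : ∀ i, L i i ≠ 0 := by
    intro i h0
    have dp' := Finset.prod_eq_zero (f := fun i => L i i) (Finset.mem_univ i) h0
    rw [dp'] at dp
    exact zero_ne_one dp
  refine ⟨Matrix.diagonal fun i => L i i, Matrix.of fun i j => (L i i)⁻¹ * L i j, ha, ⟨?_, ?_⟩, ?_, ?_⟩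
  · rw [Matrix.det_diagonal, dp]
  · intro i j hij; simp [hij]
  · rw [isNm_iff]
    refine ⟨fun i => by simp [hne i], fun i j h => hL i j ?_⟩
    simp only [Matrix.of_apply] at h
    exact right_ne_zero_of_mul h
  · rw [e, Matrix.mul_assoc]
    congr 1
    ext i j
    simp [Matrix.diagonal_mul, hne i]

/-- signed permutation matrices -/
def Sgn (u : Equiv.Perm (Fin n)) (W : Mt n) : Prop :=
  ∃ ε : Fin n → ℂ, (∀ j, ε j * ε j = 1) ∧ ∀ i j, W i j = if i = u j then ε j else 0

lemma Sgn.one : Sgn (1 : Equiv.Perm (Fin n)) 1 :=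
  ⟨fun _ => 1, by simp, fun i j => by simp only [Matrix.one_apply, Equiv.Perm.one_apply]; congr⟩

lemma Sgn.mul {u u' : Equiv.Perm (Fin n)} {W W' : Mt n} (h : Sgn u W) (h' : Sgn u' W') :
    Sgn (u * u') (W * W') := by
  obtain ⟨ε, h1, h2⟩ := h
  obtain ⟨δ, h3, h4⟩ := h'
  refine ⟨fun j => ε (u' j) * δ j, fun j => ?_, fun i j => ?_⟩
  · linear_combination (δ j * δ j) * h1 (u' j) + h3 j
  · simp [Matrix.mul_apply, h2, h4]
    congr

lemma Sgn.tmul {u : Equiv.Perm (Fin n)} {W : Mt n} (h : Sgn u W) : Wᵀ * W = 1 := by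
  obtain ⟨ε, h1, h2⟩ := h
  ext i j
  simp [Matrix.mul_apply, h2, Matrix.one_apply]
  by_cases h : i = j
  · subst h
    simpa using h1 _
  · simp [h, Ne.symm h]

lemma Sgn.mult {u : Equiv.Perm (Fin n)} {W : Mt n} (h : Sgn u W) : W * Wᵀ = 1 :=
  mul_eq_one_comm.1 h.tmul

lemma Sgn.conj {u : Equiv.Perm (Fin n)} {W : Mt n} (h : Sgn u W) :
    ∃ ε : Fin n → ℂ, (∀ j, ε j * ε j = 1) ∧
      ∀ M : Mt n, ∀ i j, (Wᵀ * M * W) i j = ε i * ε j * M (u i) (u j) := by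
  obtain ⟨ε, h1, h2⟩ := h
  refine ⟨ε, h1, fun M i j => ?_⟩
  simp [Matrix.mul_apply, h2]
  ring

lemma Sgn.tr {u : Equiv.Perm (Fin n)} {W : Mt n} (h : Sgn u W) : Sgn u⁻¹ Wᵀ := by
  obtain ⟨ε, h1, h2⟩ := h
  refine ⟨fun j => ε (u⁻¹ j), fun j => h1 _, fun i j => ?_⟩
  rw [Matrix.transpose_apply, h2]
  by_cases hh : j = u i
  · subst hh; simp
  · rw [if_neg hh, if_neg]
    rintro rfl
    simp at hh

lemma Sgn.conj' {u : Equiv.Perm (Fin n)} {W : Mt n} (h : Sgn u W) :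
    ∃ ε : Fin n → ℂ, (∀ j, ε j * ε j = 1) ∧
      ∀ M : Mt n, ∀ i j, (W * M * Wᵀ) i j = ε i * ε j * M (u⁻¹ i) (u⁻¹ j) := by
  simpa using h.tr.conj

lemma pdot_sgn (u : Equiv.Perm (Fin n)) : Sgn u (pdot u) := by
  refine ⟨fun b => (-1 : ℂ) ^ (univ.filter fun k : Fin n => b < k ∧ u k < u b).card,
    fun j => ?_, fun i j => ?_⟩
  · rw [← mul_pow]; simp
  · rfl

section step
variable {p q : Fin n}

lemma sperm_eq_s15 {k : ℕ} (hp : (p : ℕ) + 1 = k) (hq : (q : ℕ) = k) :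
    sperm n k = Equiv.swap p q := by
  have hk : k < n := hq ▸ q.2
  unfold sperm
  rw [dif_pos hk]
  congr 1
  · ext; simp; omega
  · ext; simp; omega

lemma xmat_eq {k : ℕ} (hp : (p : ℕ) + 1 = k) (hq : (q : ℕ) = k) (t : ℂ) :
    (xmat k t : Mt n) = Matrix.transvection p q t := by
  ext i j
  have e1 : (i : ℕ) + 1 = k ↔ i = p := by rw [Fin.ext_iff]; omega
  have e2 : (j : ℕ) = k ↔ j = q := by rw [Fin.ext_iff]; omega
  have hpq : p ≠ q := by rw [Ne, Fin.ext_iff]; omega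
  simp only [xmat, Matrix.of_apply, e1, e2, Matrix.transvection, Matrix.add_apply,
    Matrix.one_apply, Matrix.single_apply]
  by_cases hij : i = j
  · subst hij
    have : ¬ (p = i ∧ q = i) := by rintro ⟨rfl, h⟩; exact hpq h.symm
    simp [this]
  · simp [hij, eq_comm]

lemma sdot_eq {k : ℕ} (hp : (p : ℕ) + 1 = k) (hq : (q : ℕ) = k) (i j : Fin n) :
    (sdot k : Mt n) i j = if i = p ∧ j = q then 1 else if i = q ∧ j = p then -1 else
      if i = j ∧ i ≠ p ∧ i ≠ q then 1 else 0 := by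
  have e1 : ∀ i : Fin n, (i : ℕ) + 1 = k ↔ i = p := by intro i; rw [Fin.ext_iff]; omega
  have e2 : ∀ j : Fin n, (j : ℕ) = k ↔ j = q := by intro i; rw [Fin.ext_iff]; omega
  simp only [sdot, Matrix.of_apply, e1, e2, Ne]

lemma sdot_sgn {k : ℕ} (hp : (p : ℕ) + 1 = k) (hq : (q : ℕ) = k) :
    Sgn (Equiv.swap p q) (sdot k) := by
  have hpq : p ≠ q := by rw [Ne, Fin.ext_iff]; omega
  refine ⟨fun j => if j = p then -1 else 1, fun j => by by_cases h : j = p <;> simp [h], fun i j => ?_⟩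
  rw [sdot_eq hp hq, Equiv.swap_apply_def]
  grind

lemma sdot_fac {k : ℕ} (hp : (p : ℕ) + 1 = k) (hq : (q : ℕ) = k) :
    (sdot k : Mt n) = Matrix.transvection p q 1 *
      (Matrix.transvection q p (-1) * Matrix.transvection p q 1) := by
  have hpq : p ≠ q := by rw [Ne, Fin.ext_iff]; omega
  ext i j
  rw [sdot_eq hp hq]
  by_cases h1 : i = p
  · subst h1
    rw [Matrix.transvection_mul_apply_same, Matrix.transvection_mul_apply_of_ne _ _ _ _ hpq,
      Matrix.transvection_mul_apply_same]
    simp [Matrix.transvection, Matrix.one_apply, Matrix.single_apply]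
    grind
  · rw [Matrix.transvection_mul_apply_of_ne _ _ _ _ h1]
    by_cases h2 : i = q
    · subst h2
      rw [Matrix.transvection_mul_apply_same]
      simp [Matrix.transvection, Matrix.one_apply, Matrix.single_apply]
      grind
    · rw [Matrix.transvection_mul_apply_of_ne _ _ _ _ h2]
      simp [Matrix.transvection, Matrix.one_apply, Matrix.single_apply]
      grind

lemma sdot_det {k : ℕ} (hp : (p : ℕ) + 1 = k) (hq : (q : ℕ) = k) :
    (sdot k : Mt n).det = 1 := by
  have hpq : p ≠ q := by rw [Ne, Fin.ext_iff]; omega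
  rw [sdot_fac hp hq, Matrix.det_mul, Matrix.det_mul, Matrix.det_transvection_of_ne _ _ hpq,
    Matrix.det_transvection_of_ne _ _ hpq.symm]
  simp

def Ym (p q : Fin n) (t : ℂ) : Mt n := Matrix.of fun i j =>
  if i = p ∧ j = p then t⁻¹ else if i = q ∧ j = p then -1 else if i = q ∧ j = q then t
  else if i = j then 1 else 0

lemma x_fac {k : ℕ} (hp : (p : ℕ) + 1 = k) (hq : (q : ℕ) = k) {t : ℂ} (ht : t ≠ 0) :
    (xmat k t : Mt n)ᵀ * sdot k = Matrix.transvection p q t⁻¹ * Ym p q t := by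
  have hpq : p ≠ q := by rw [Ne, Fin.ext_iff]; omega
  have e : (xmat k t : Mt n)ᵀ = Matrix.transvection q p t := by
    rw [xmat_eq hp hq]; simp [Matrix.transvection]
  rw [e]
  ext i j
  by_cases h1 : i = p
  · subst h1
    rw [Matrix.transvection_mul_apply_same, Matrix.transvection_mul_apply_of_ne _ _ _ _ hpq]
    simp only [sdot_eq hp hq, Ym, Matrix.of_apply]
    grind
  · rw [Matrix.transvection_mul_apply_of_ne _ _ _ _ h1]
    by_cases h2 : i = q
    · subst h2
      rw [Matrix.transvection_mul_apply_same]
      simp only [sdot_eq hp hq, Ym, Matrix.of_apply]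
      grind
    · rw [Matrix.transvection_mul_apply_of_ne _ _ _ _ h2]
      simp only [sdot_eq hp hq, Ym, Matrix.of_apply]
      grind

/-- swap of adjacent preserves order except on the pair -/
lemma swap_le (hpq : (p : ℕ) + 1 = q) {i j : Fin n}
    (h : Equiv.swap p q i ≤ Equiv.swap p q j)
    (hne : ¬ (Equiv.swap p q i = p ∧ Equiv.swap p q j = q)) : i ≤ j := by
  simp only [Equiv.swap_apply_def] at h hne
  rw [Fin.le_def] at *
  have e1 : ∀ i : Fin n, i = p ↔ (i : ℕ) = p := fun i => Fin.ext_iff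
  have e2 : ∀ i : Fin n, i = q ↔ (i : ℕ) = q := fun i => Fin.ext_iff
  simp only [e1, e2] at h hne
  split_ifs at h hne <;> simp_all <;> omega

lemma transv_pat {R : Fin n → Fin n → Prop} (hr : ∀ i, R i i) (h : R p q) (c : ℂ) :
    Pat R (Matrix.transvection p q c) := by
  intro i j hne
  simp only [Matrix.transvection, Matrix.add_apply, Matrix.one_apply, Matrix.single_apply] at hne
  by_cases hij : i = j
  · subst hij; exact hr _
  · by_cases h2 : p = i ∧ q = j
    · obtain ⟨rfl, rfl⟩ := h2; exact h
    · simp [hij, h2] at hne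

lemma transv_diag (hpq : p ≠ q) (c : ℂ) (i : Fin n) :
    (Matrix.transvection p q c) i i = 1 := by
  have : ¬ (p = i ∧ q = i) := by rintro ⟨rfl, h⟩; exact hpq h.symm
  simp [Matrix.transvection, Matrix.single_apply, this]

def Dec (σ : Equiv.Perm (Fin n)) : Prop :=
  ∀ γ : Mt n, Pat (· ≤ ·) γ → (∀ i, γ i i ≠ 0) → ∃ γ1 γ2 : Mt n, γ = γ1 * γ2 ∧
    (∀ i, γ1 i i = 1) ∧ Pat (RN σ) γ1 ∧ Pat (RM σ) γ2 ∧ ∀ i, γ2 i i ≠ 0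

lemma dec_one : Dec (1 : Equiv.Perm (Fin n)) := by
  intro γ hγ hd
  refine ⟨Matrix.of fun i j => γ i j * (γ j j)⁻¹, Matrix.diagonal fun i => γ i i, ?_, ?_, ?_, ?_, ?_⟩
  · ext i j; simp [Matrix.mul_diagonal, hd j]
  · intro i; simp [hd i]
  · intro i j h
    have := hγ i j (left_ne_zero_of_mul h)
    exact ⟨this, this⟩
  · intro i j h
    have : i = j := by by_contra hc; simp [hc] at h
    subst this; exact ⟨le_rfl, le_rfl⟩
  · simpa using hd

/-- conjugated pattern -/
lemma RN_swap (hpq : (p : ℕ) + 1 = q) (σ : Equiv.Perm (Fin n)) {i j : Fin n}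
    (h : RN σ (Equiv.swap p q i) (Equiv.swap p q j))
    (hne : ¬ (Equiv.swap p q i = p ∧ Equiv.swap p q j = q)) : RN (σ * Equiv.swap p q) i j :=
  ⟨swap_le hpq h.1 hne, h.2⟩

lemma RM_swap (hpq : (p : ℕ) + 1 = q) (σ : Equiv.Perm (Fin n)) (hσ : σ p < σ q) {i j : Fin n}
    (h : RM σ (Equiv.swap p q i) (Equiv.swap p q j)) : RM (σ * Equiv.swap p q) i j :=
  ⟨swap_le hpq h.1 (by rintro ⟨h1, h2⟩; rw [h1, h2] at h; exact absurd h.2 (not_le.2 hσ)), h.2⟩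

lemma dec_step (hpq : (p : ℕ) + 1 = q) {σ : Equiv.Perm (Fin n)} (hσ : σ p < σ q)
    (hD : Dec σ) : Dec (σ * Equiv.swap p q) := by
  intro γ hγ hd
  have hne : p ≠ q := by rw [Ne, Fin.ext_iff]; omega
  have hle : p ≤ q := by rw [Fin.le_def]; omega
  set c := γ p q / γ p p with hc
  set γ0 := γ * Matrix.transvection p q (-c) with h0
  have pt : ∀ c : ℂ, Pat (· ≤ ·) (Matrix.transvection p q c) :=
    fun c => transv_pat (fun i => le_rfl) hle c
  have p0 : Pat (· ≤ ·) γ0 := Pat.mul up_trans hγ (pt _)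
  have d0 : ∀ i, γ0 i i ≠ 0 := by
    intro i
    rw [h0, Pat.diag_mul up_anti hγ (pt _), transv_diag hne, mul_one]; exact hd i
  have z0 : γ0 p q = 0 := by
    rw [h0, Matrix.mul_transvection_apply_same, hc]
    have := hd p
    field_simp; ring
  set s := Equiv.swap p q with hs
  obtain ⟨γ1, γ2, e, d1, p1, p2, d2⟩ := hD (γ0.submatrix s s)
    (fun i j h => swap_le hpq (p0 _ _ h) (by
      rintro ⟨h1, h2⟩
      rw [Matrix.submatrix_apply, hs, h1, h2] at h; exact h z0))
    (fun i => d0 _)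
  have z1 : γ1 p q = 0 := by
    have h1 : (γ1 * γ2) p q = γ1 p q * γ2 q q := by
      rw [Matrix.mul_apply]
      apply Finset.sum_eq_single q
      · intro k _ hk
        by_contra hcon
        have a1 := (p1 _ _ (left_ne_zero_of_mul hcon)).1
        have a2 := p2 _ _ (right_ne_zero_of_mul hcon)
        have : k = p := by
          have b1 := a2.1
          rw [Fin.le_def] at a1 b1
          rw [Ne, Fin.ext_iff] at hk
          rw [Fin.ext_iff]; omega
        subst this
        exact absurd a2.2 (not_le.2 hσ)
      · simp
    have h2 : (γ1 * γ2) p q = 0 := by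
      rw [← e, Matrix.submatrix_apply, hs, Equiv.swap_apply_left, Equiv.swap_apply_right]
      by_contra hcon
      exact hne (le_antisymm hle (p0 _ _ hcon))
    rw [h2] at h1
    exact (mul_eq_zero.1 h1.symm).resolve_right (d2 q)
  have ss : ∀ i, s (s i) = i := fun i => Equiv.swap_apply_self p q i
  have e0 : γ0 = γ1.submatrix s s * γ2.submatrix s s := by
    rw [Matrix.submatrix_mul_equiv, ← e]
    ext i j
    simp [ss]
  have eT : γ = γ0 * Matrix.transvection p q c := by
    rw [h0, Matrix.mul_assoc, Matrix.transvection_mul_transvection_same _ _ hne]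
    simp
  have pT : Pat (RM (σ * s)) (Matrix.transvection p q c) :=
    transv_pat (fun i => ⟨le_rfl, le_rfl⟩) ⟨hle, by simp [hs, hσ.le]⟩ c
  have pS : Pat (RM (σ * s)) (γ2.submatrix s s) := fun i j h => RM_swap hpq σ hσ (p2 _ _ h)
  refine ⟨γ1.submatrix s s, γ2.submatrix s s * Matrix.transvection p q c, ?_, ?_, ?_, ?_, ?_⟩
  · rw [← Matrix.mul_assoc, ← e0, ← eT]
  · intro i; exact d1 _
  · intro i j h
    refine RN_swap hpq σ (p1 _ _ h) ?_
    rintro ⟨h1, h2⟩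
    rw [Matrix.submatrix_apply, hs, h1, h2] at h; exact h z1
  · exact Pat.mul (RM_trans _) pS pT
  · intro i
    rw [Pat.diag_mul (fun i j h h' => le_antisymm h.1 h'.1) pS pT, transv_diag hne, mul_one]
    exact d2 _

lemma conj_sdot_pat {k : ℕ} (hp : (p : ℕ) + 1 = k) (hq : (q : ℕ) = k)
    {σ : Equiv.Perm (Fin n)} (hσ : σ p < σ q) {β : Mt n} (hβ : Pat (RM σ) β)
    (hd : ∀ i, β i i ≠ 0) :
    Pat (RM (σ * Equiv.swap p q)) ((sdot k : Mt n) * β * (sdot k : Mt n)ᵀ) ∧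
      ∀ i, ((sdot k : Mt n) * β * (sdot k : Mt n)ᵀ) i i ≠ 0 := by
  obtain ⟨ε, h1, h2⟩ := (sdot_sgn hp hq : Sgn _ (sdot k : Mt n)).conj'
  refine ⟨fun i j h => ?_, fun i => ?_⟩
  · rw [h2] at h
    exact RM_swap (by omega) σ hσ (hβ _ _ (by simpa using right_ne_zero_of_mul h))
  · rw [h2, h1, one_mul]; exact hd _

lemma conj_Y_pat {k : ℕ} (hp : (p : ℕ) + 1 = k) (hq : (q : ℕ) = k)
    {σ : Equiv.Perm (Fin n)} (hσ : σ p < σ q) {t : ℂ} (ht : t ≠ 0) :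
    Pat (RM (σ * Equiv.swap p q)) ((sdot k : Mt n) * Ym p q t * (sdot k : Mt n)ᵀ) ∧
      ∀ i, ((sdot k : Mt n) * Ym p q t * (sdot k : Mt n)ᵀ) i i ≠ 0 := by
  obtain ⟨ε, h1, h2⟩ := (sdot_sgn hp hq : Sgn _ (sdot k : Mt n)).conj'
  have hle : p ≤ q := by rw [Fin.le_def]; omega
  refine ⟨fun i j h => ?_, fun i => ?_⟩
  · rw [h2] at h
    have h3 := right_ne_zero_of_mul h
    by_cases hij : i = j
    · subst hij; exact ⟨le_rfl, le_rfl⟩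
    · have hij' : (Equiv.swap p q)⁻¹ i ≠ (Equiv.swap p q)⁻¹ j := by simpa using hij
      have h4 : (Equiv.swap p q)⁻¹ i = q ∧ (Equiv.swap p q)⁻¹ j = p := by
        simp only [Ym, Matrix.of_apply] at h3
        generalize (Equiv.swap p q)⁻¹ i = x at *
        generalize (Equiv.swap p q)⁻¹ j = y at *
        grind
      have hi : i = p := by rw [Equiv.Perm.inv_eq_iff_eq] at h4; simpa using h4.1
      have hj : j = q := by
        have := h4.2; rw [Equiv.Perm.inv_eq_iff_eq] at this; simpa using this
      subst hi hj
      exact ⟨hle, by simp [hσ.le]⟩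
  · rw [h2, h1, one_mul]
    generalize (Equiv.swap p q)⁻¹ i = x
    simp only [Ym, Matrix.of_apply]
    have := inv_ne_zero ht
    grind

lemma len_step (hpq : (p : ℕ) + 1 = q) (u : Equiv.Perm (Fin n)) :
    len (Equiv.swap p q * u) ≤ len u + 1 ∧
      (¬ u⁻¹ p < u⁻¹ q → len (Equiv.swap p q * u) ≤ len u) := by
  have key : ∀ x : Fin n × Fin n, x.1 < x.2 ∧ (Equiv.swap p q * u) x.2 < (Equiv.swap p q * u) x.1 →
      (x.1 < x.2 ∧ u x.2 < u x.1) ∨ (x = (u⁻¹ p, u⁻¹ q) ∧ x.1 < x.2) := by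
    rintro ⟨a, b⟩ ⟨h1, h2⟩
    simp only at h1 h2 ⊢
    by_cases hc : u a = p ∧ u b = q
    · right
      refine ⟨?_, h1⟩
      rw [← hc.1, ← hc.2]; simp
    · left
      refine ⟨h1, ?_⟩
      by_contra hlt
      have hlt := not_lt.1 hlt
      have : Equiv.swap p q (u a) ≤ Equiv.swap p q (u b) := by
        apply swap_le hpq
        · simpa using hlt
        · simpa using hc
      exact absurd h2 (not_lt.2 this)
  unfold len
  constructor
  · refine le_trans (Finset.card_le_card (t := insert (u⁻¹ p, u⁻¹ q)
      (univ.filter fun x : Fin n × Fin n => x.1 < x.2 ∧ u x.2 < u x.1)) ?_) (Finset.card_insert_le _ _)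
    intro x hx
    rw [Finset.mem_filter] at hx
    rw [Finset.mem_insert, Finset.mem_filter]
    rcases key x hx.2 with h | h
    · exact Or.inr ⟨Finset.mem_univ _, h⟩
    · exact Or.inl h.1
  · intro hn
    apply Finset.card_le_card
    intro x hx
    rw [Finset.mem_filter] at hx ⊢
    rcases key x hx.2 with h | h
    · exact ⟨Finset.mem_univ _, h⟩
    · rw [h.1] at h; exact absurd h.2 hn

end step

/-- main one-step lemma -/
lemma main_step {p q : Fin n} {k : ℕ} (hp : (p : ℕ) + 1 = k) (hq : (q : ℕ) = k)
    {u : Equiv.Perm (Fin n)} (hσ : u⁻¹ p < u⁻¹ q) {F W a β : Mt n} (hW : Sgn u W) (hD : Dec u⁻¹)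
    (ha : IsN a) (hβ : Pat (RM u⁻¹) β) (hd : ∀ i, β i i ≠ 0)
    (e : F * W = a * (Wᵀ * β * W)) (g : Mt n)
    (hg : g = sdot k ∨ ∃ t : ℂ, t ≠ 0 ∧ g = xmat k t) :
    ∃ h β1 : Mt n, IsN h ∧ Pat (RN u) h ∧ Pat (RM (u⁻¹ * Equiv.swap p q)) β1 ∧
      (∀ i, β1 i i ≠ 0) ∧
      F * gᵀ * (sdot k * W) = (a * h) * ((sdot k * W)ᵀ * β1 * (sdot k * W)) := by
  have hS : Sgn (Equiv.swap p q) (sdot k : Mt n) := sdot_sgn hp hq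
  have hSS := hS.tmul
  have hWW := hW.mult
  have hle : p ≤ q := by rw [Fin.le_def]; omega
  have hne : p ≠ q := by rw [Ne, Fin.ext_iff]; omega
  set S : Mt n := sdot k with hSdef
  have cs : ∀ X : Mt n, Sᵀ * (S * X) = X := fun X => by
    rw [← Matrix.mul_assoc, hSS, Matrix.one_mul]
  have cw : ∀ X : Mt n, W * (Wᵀ * X) = X := fun X => by
    rw [← Matrix.mul_assoc, hWW, Matrix.one_mul]
  have e' : F = a * (Wᵀ * β) := by
    calc F = F * W * Wᵀ := by rw [Matrix.mul_assoc, hWW, Matrix.mul_one]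
      _ = a * (Wᵀ * β) := by
        rw [e]; simp only [Matrix.mul_assoc, hWW, Matrix.mul_one]
  rcases hg with rfl | ⟨t, ht, rfl⟩
  · obtain ⟨h1, h2⟩ := conj_sdot_pat hp hq hσ hβ hd
    refine ⟨1, S * β * Sᵀ, ?_, ?_, h1, h2, ?_⟩
    · exact ⟨by simp, fun i j h => Matrix.one_apply_ne h.ne'⟩
    · intro i j h
      have : i = j := by by_contra hc; simp [hc] at h
      subst this; exact ⟨le_rfl, le_rfl⟩
    · rw [e']
      simp only [Matrix.mul_assoc, Matrix.transpose_mul, cs, Matrix.one_mul]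
  · have pt : Pat (· ≤ ·) (Matrix.transvection p q t⁻¹) :=
      transv_pat (fun i => le_rfl) hle _
    have pβ : Pat (· ≤ ·) β := hβ.mono fun i j h => h.1
    obtain ⟨γ1, γ2, eγ, d1, p1, p2, d2⟩ := hD (β * Matrix.transvection p q t⁻¹)
      (Pat.mul up_trans pβ pt)
      (fun i => by rw [Pat.diag_mul up_anti pβ pt, transv_diag hne, mul_one]; exact hd i)
    obtain ⟨h1, h2⟩ := conj_sdot_pat hp hq hσ p2 d2
    obtain ⟨h3, h4⟩ := conj_Y_pat hp hq hσ ht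
    obtain ⟨ε, c1, c2⟩ := hW.conj
    have pr : Pat (RN u) (Wᵀ * γ1 * W) := by
      intro i j h
      rw [c2] at h
      have := p1 _ _ (right_ne_zero_of_mul h)
      exact ⟨by simpa using this.2, this.1⟩
    refine ⟨Wᵀ * γ1 * W, (S * γ2 * Sᵀ) * (S * Ym p q t * Sᵀ), ?_, pr,
      Pat.mul (RM_trans _) h1 h3, ?_, ?_⟩
    · rw [isN_iff]
      refine ⟨fun i => by rw [c2, c1, d1, mul_one], pr.mono fun i j h => h.1⟩
    · intro i
      rw [Pat.diag_mul (fun i j h h' => le_antisymm h.1 h'.1) h1 h3]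
      exact mul_ne_zero (h2 i) (h4 i)
    · have xf := x_fac hp hq ht
      rw [← hSdef] at xf
      calc F * (xmat k t : Mt n)ᵀ * (S * W) = a * (Wᵀ * (β * (((xmat k t : Mt n)ᵀ * S) * W))) := by
            rw [e']; simp only [Matrix.mul_assoc]
        _ = a * (Wᵀ * ((β * Matrix.transvection p q t⁻¹) * (Ym p q t * W))) := by
            rw [xf]; simp only [Matrix.mul_assoc]
        _ = _ := by
            rw [eγ]
            simp only [Matrix.mul_assoc, Matrix.transpose_mul, cs, cw]

lemma low_of_RM {u : Equiv.Perm (Fin n)} {W β : Mt n} (hW : Sgn u W) (hβ : Pat (RM u⁻¹) β) :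
    Pat (fun i j => j ≤ i) (Wᵀ * β * W) := by
  obtain ⟨ε, c1, c2⟩ := hW.conj
  intro i j h
  rw [c2] at h
  simpa using (hβ _ _ (right_ne_zero_of_mul h)).2

structure Inv (u : Equiv.Perm (Fin n)) (W F a : Mt n) : Prop where
  sg : Sgn u W
  dec : Dec u⁻¹
  dW : W.det = 1
  dF : F.det = 1
  aN : IsN a
  ex : ∃ β, Pat (RM u⁻¹) β ∧ (∀ i, β i i ≠ 0) ∧ F * W = a * (Wᵀ * β * W)

lemma Inv.udl {u : Equiv.Perm (Fin n)} {W F a : Mt n} (h : Inv u W F a) :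
    ∃ b c, UDL (F * W) a b c := by
  obtain ⟨β, h1, h2, h3⟩ := h.ex
  exact UDL_of_low h.aN (low_of_RM h.sg h1) (by rw [Matrix.det_mul, h.dW, h.dF, one_mul]) h3

lemma UDL_unique {A a b c a' b' c' : Mt n} (h : UDL A a b c) (h' : UDL A a' b' c') : a = a' := by
  obtain ⟨h1, h2, h3⟩ := UDL_low h
  obtain ⟨h1', h2', h3'⟩ := UDL_low h'
  exact UL_unique h.1 h'.1 h1 h1' h2 (h3 ▸ h3')

lemma isN_one : IsN (1 : Mt n) := ⟨by simp, fun i j h => Matrix.one_apply_ne h.ne'⟩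

lemma isN_mul {a b : Mt n} (ha : IsN a) (hb : IsN b) : IsN (a * b) := by
  rw [isN_iff] at *
  exact ⟨fun i => by rw [Pat.diag_mul up_anti ha.2 hb.2, ha.1, hb.1, one_mul],
    Pat.mul up_trans ha.2 hb.2⟩

lemma isN_pdot {u : Equiv.Perm (Fin n)} {h : Mt n} (hN : IsN h) (hp : Pat (RN u) h) :
    IsN ((pdot u : Mt n) * h * (pdot u : Mt n)⁻¹) := by
  have hs := pdot_sgn u
  rw [Matrix.inv_eq_right_inv hs.mult]
  obtain ⟨ε, c1, c2⟩ := hs.conj'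
  rw [isN_iff]
  refine ⟨fun i => by rw [c2, c1, hN.1, one_mul], fun i j hne => ?_⟩
  rw [c2] at hne
  simpa using (hp _ _ (right_ne_zero_of_mul hne)).2

lemma RN_mono {p q : Fin n} (hpq : (p : ℕ) + 1 = q) {u : Equiv.Perm (Fin n)}
    (hσ : u⁻¹ p < u⁻¹ q) {i j : Fin n} (h : RN (Equiv.swap p q * u) i j) : RN u i j := by
  refine ⟨h.1, swap_le hpq h.2 ?_⟩
  rintro ⟨h1, h2⟩
  have h1' : u i = q := by
    have := congrArg (Equiv.swap p q) h1; simpa using this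
  have h2' : u j = p := by
    have := congrArg (Equiv.swap p q) h2; simpa using this
  rw [← h1', ← h2'] at hσ
  simp at hσ
  exact absurd h.1 (not_le.2 hσ)

lemma drop_cons {α : Type*} (f : Fin m → α) (r : ℕ) (hr : r < m) :
    (List.ofFn f).drop r = f ⟨r, hr⟩ :: (List.ofFn f).drop (r + 1) := by
  rw [List.drop_eq_getElem_cons (by simpa using hr)]
  simp

lemma pq_exists {k : ℕ} (h1 : 1 ≤ k) (h2 : k < n) :
    ∃ p q : Fin n, (p : ℕ) + 1 = k ∧ (q : ℕ) = k :=
  ⟨⟨k - 1, by omega⟩, ⟨k, h2⟩, by simp; omega, rfl⟩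

lemma len_drop (ii : Fin m → ℕ) (hii : ∀ r, 1 ≤ ii r ∧ ii r < n)
    (hred : len (sPermList n ii).prod = m) : ∀ r, r ≤ m →
    len ((sPermList n ii).drop r).prod ≤ m - r ∧ m - r ≤ len ((sPermList n ii).drop r).prod := by
  intro r hr
  constructor
  · induction hr using Nat.decreasingInduction with
    | self =>
      have : (sPermList n ii).drop m = [] := by simp [sPermList]
      rw [this, List.prod_nil, len_one]; simp
    | of_succ r hr ih =>
      obtain ⟨p, q, hp, hq⟩ := pq_exists (hii ⟨r, hr⟩).1 (hii ⟨r, hr⟩).2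
      unfold sPermList at ih ⊢
      rw [drop_cons _ r hr, List.prod_cons, sperm_eq_s15 hp hq]
      have := (len_step (by omega : (p : ℕ) + 1 = q) (List.drop (r + 1) (List.ofFn fun r => sperm n (ii r))).prod).1
      omega
  · induction r with
    | zero => rw [List.drop_zero, hred]; simp
    | succ r ih =>
      have ih := ih (by omega)
      obtain ⟨p, q, hp, hq⟩ := pq_exists (hii ⟨r, hr⟩).1 (hii ⟨r, hr⟩).2
      unfold sPermList at ih ⊢
      rw [drop_cons _ r hr, List.prod_cons, sperm_eq_s15 hp hq] at ih
      have := (len_step (by omega : (p : ℕ) + 1 = q) (List.drop (r + 1) (List.ofFn fun r => sperm n (ii r))).prod).1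
      omega

lemma main_ind (ii : Fin m → ℕ) (hii : ∀ r, 1 ≤ ii r ∧ ii r < n)
    (hred : len (sPermList n ii).prod = m) (v : Equiv.Perm (Fin n))
    (t : Fin m → ℂ) (ht : ∀ r, inJ ii v r → t r ≠ 0) : ∀ r, r ≤ m →
    ∃ a : Mt n, Inv ((sPermList n ii).drop r).prod ((sdotList n ii).drop r).prod
      (((mrgList ii v t).drop r).prod)ᵀ a ∧
      ∀ r', r ≤ r' → r' ≤ m →
        (∀ i j, RN ((sPermList n ii).drop r).prod i j → RN ((sPermList n ii).drop r').prod i j) ∧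
        ∀ a' b' c', UDL ((((mrgList ii v t).drop r').prod)ᵀ *
            ((sdotList n ii).drop r').prod) a' b' c' →
          ∃ h : Mt n, IsN h ∧ Pat (RN ((sPermList n ii).drop r').prod) h ∧ a = a' * h := by
  intro r hr
  have self : ∀ r, ∀ a : Mt n, Inv ((sPermList n ii).drop r).prod ((sdotList n ii).drop r).prod
      (((mrgList ii v t).drop r).prod)ᵀ a → ∀ a' b' c', UDL ((((mrgList ii v t).drop r).prod)ᵀ *
            ((sdotList n ii).drop r).prod) a' b' c' →
          ∃ h : Mt n, IsN h ∧ Pat (RN ((sPermList n ii).drop r).prod) h ∧ a = a' * h := by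
    intro r a hI a' b' c' h'
    obtain ⟨b, c, h⟩ := hI.udl
    refine ⟨1, isN_one, ?_, by rw [Matrix.mul_one]; exact UDL_unique h h'⟩
    intro i j h
    have : i = j := by by_contra hc; simp [hc] at h
    subst this; exact ⟨le_rfl, le_rfl⟩
  induction hr using Nat.decreasingInduction with
  | self =>
    have I : Inv ((sPermList n ii).drop m).prod ((sdotList n ii).drop m).prod
      (((mrgList ii v t).drop m).prod)ᵀ (1 : Mt n) := by
      have e1 : (sPermList n ii).drop m = [] := by simp [sPermList]
      have e2 : (sdotList n ii : List (Mt n)).drop m = [] := by simp [sdotList]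
      have e3 : (mrgList ii v t).drop m = [] := by simp [mrgList]
      rw [e1, e2, e3]
      refine ⟨Sgn.one, by simpa using dec_one, by simp, by simp, isN_one, 1, ?_, by simp, by simp⟩
      intro i j h
      have : i = j := by by_contra hc; simp [hc] at h
      subst this; exact ⟨le_rfl, le_rfl⟩
    refine ⟨1, I, fun r' h1 h2 => ?_⟩
    obtain rfl : m = r' := le_antisymm h1 h2
    exact ⟨fun i j h => h, self _ _ I⟩
  | of_succ r hr ih =>
    obtain ⟨a, I, H⟩ := ih
    obtain ⟨p, q, hp, hq⟩ := pq_exists (hii ⟨r, hr⟩).1 (hii ⟨r, hr⟩).2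
    have hpq : (p : ℕ) + 1 = q := by omega
    have E1 : ((sPermList n ii).drop r).prod =
        Equiv.swap p q * ((sPermList n ii).drop (r + 1)).prod := by
      unfold sPermList
      rw [drop_cons _ r hr, List.prod_cons, sperm_eq_s15 hp hq]
    have E2 : ((sdotList n ii : List (Mt n)).drop r).prod =
        sdot (ii ⟨r, hr⟩) * ((sdotList n ii : List (Mt n)).drop (r + 1)).prod := by
      unfold sdotList
      rw [drop_cons _ r hr, List.prod_cons]
    obtain ⟨g, hg, E3⟩ : ∃ g : Mt n, (g = sdot (ii ⟨r, hr⟩) ∨ ∃ t : ℂ, t ≠ 0 ∧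
        g = xmat (ii ⟨r, hr⟩) t) ∧ ((mrgList ii v t).drop r).prod =
        g * ((mrgList ii v t).drop (r + 1)).prod := by
      refine ⟨if inJ ii v ⟨r, hr⟩ then xmat (ii ⟨r, hr⟩) (t ⟨r, hr⟩) else sdot (ii ⟨r, hr⟩), ?_, ?_⟩
      · split_ifs with hJ
        · exact Or.inr ⟨_, ht _ hJ, rfl⟩
        · exact Or.inl rfl
      · unfold mrgList
        rw [drop_cons _ r hr, List.prod_cons]
    have l1 := len_drop ii hii hred r hr.le
    have l2 := len_drop ii hii hred (r + 1) hr
    rw [E1] at l1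
    have dg : g.det = 1 := by
      rcases hg with rfl | ⟨t, -, rfl⟩
      · exact sdot_det hp hq
      · rw [xmat_eq hp hq, Matrix.det_transvection_of_ne]
        rw [Ne, Fin.ext_iff]; omega
    have E3' : (((mrgList ii v t).drop r).prod)ᵀ = (((mrgList ii v t).drop (r + 1)).prod)ᵀ * gᵀ := by
      rw [E3, Matrix.transpose_mul]
    set u := ((sPermList n ii).drop (r + 1)).prod with hu
    have hσ : u⁻¹ p < u⁻¹ q := by
      by_contra hc
      have := (len_step hpq u).2 hc
      omega
    obtain ⟨β, b1, b2, b3⟩ := I.ex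
    obtain ⟨h, β1, hN, hP, q1, q2, q3⟩ := main_step hp hq hσ I.sg I.dec I.aN b1 b2 b3 g hg
    have inv_eq : (Equiv.swap p q * u)⁻¹ = u⁻¹ * Equiv.swap p q := by
      rw [_root_.mul_inv_rev, Equiv.swap_inv]
    have I' : Inv ((sPermList n ii).drop r).prod ((sdotList n ii).drop r).prod
      (((mrgList ii v t).drop r).prod)ᵀ (a * h) := by
      rw [E1, E2, E3']
      refine ⟨(sdot_sgn hp hq).mul I.sg, ?_, ?_, ?_, isN_mul I.aN hN, β1, ?_, q2, q3⟩
      · rw [inv_eq]; exact dec_step hpq hσ I.dec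
      · rw [Matrix.det_mul, I.dW, sdot_det hp hq, one_mul]
      · rw [Matrix.det_mul, I.dF, Matrix.det_transpose, dg, one_mul]
      · rw [inv_eq]; exact q1
    refine ⟨a * h, I', fun r' h1 h2 => ?_⟩
    rcases h1.eq_or_lt with rfl | h1
    · exact ⟨fun i j h => h, self _ _ I'⟩
    · obtain ⟨H1, H2⟩ := H r' h1 h2
      refine ⟨fun i j hh => H1 i j (RN_mono hpq hσ (by rwa [E1] at hh)), fun a' b' c' hU => ?_⟩
      obtain ⟨h', n1, n2, n3⟩ := H2 a' b' c' hU
      exact ⟨h' * h, isN_mul n1 hN, Pat.mul (RN_trans _) n2 (hP.mono H1),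
        by rw [n3, Matrix.mul_assoc]⟩

/-- `y⃗ ∈ y^{(r)}·N'(s_{i_r}⋯s_{i_m})` (Lemma 7.9, type A). -/
theorem statement_15 {n m : ℕ} (hn : 1 ≤ n) (ii : Fin m → ℕ)
    (hii : ∀ r, 1 ≤ ii r ∧ ii r < n)
    (w : Equiv.Perm (Fin n)) (hw : w = (sPermList n ii).prod) (hred : len w = m)
    (v : Equiv.Perm (Fin n)) (hv0 : vseq ii v m = 1)
    (t : Fin m → ℂ) (ht : ∀ r, inJ ii v r → t r ≠ 0) :
    (∃ a b c, UDL ((mrg ii v t)ᵀ * wMR n ii) a b c) ∧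
    ∀ a b c, UDL ((mrg ii v t)ᵀ * wMR n ii) a b c →
      ∀ r : ℕ, 1 ≤ r → r ≤ m →
        (∃ a' b' c', UDL ((((mrgList ii v t).drop (r - 1)).prod)ᵀ *
            ((sdotList n ii).drop (r - 1)).prod) a' b' c') ∧
        ∀ a' b' c', UDL ((((mrgList ii v t).drop (r - 1)).prod)ᵀ *
            ((sdotList n ii).drop (r - 1)).prod) a' b' c' →
          ∃ h : Matrix (Fin n) (Fin n) ℂ, IsN h ∧
            IsN (pdot (((sPermList n ii).drop (r - 1)).prod) * h *
              (pdot (((sPermList n ii).drop (r - 1)).prod) :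
                Matrix (Fin n) (Fin n) ℂ)⁻¹) ∧
            a = a' * h := by
  subst hw
  obtain ⟨a0, I0, H0⟩ := main_ind ii hii hred v t ht 0 (Nat.zero_le _)
  obtain ⟨b0, c0, U0⟩ := I0.udl
  rw [List.drop_zero, List.drop_zero] at U0
  refine ⟨⟨a0, b0, c0, U0⟩, fun a b c hU r h1 h2 => ⟨?_, fun a' b' c' hU' => ?_⟩⟩
  · obtain ⟨a1, I1, -⟩ := main_ind ii hii hred v t ht (r - 1) (by omega)
    exact ⟨a1, I1.udl⟩
  · obtain ⟨h, n1, n2, n3⟩ := (H0 (r - 1) (Nat.zero_le _) (by omega)).2 a' b' c' hU'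
    exact ⟨h, n1, isN_pdot n1 n2, by rw [← n3]; exact UDL_unique hU U0⟩

end
end Paper
end
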